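/- arXiv:1608.04311 — 3 statements merged into one kernel-verified Lean document; each statement's English description precedes it below -/
import Mathlib

section
/- Let t0 < tm, umax > 0, v0 ≥ 0, L > 0. Let p : [t0, tm] → ℝ be differentiable with p(t0) = 0 and p'(t) ≤ v0 + umax·(t − t0) for all t ∈ [t0, tm]. If p(tm) = L, then tm ≥ t0 + (√(2·L·umax + v0²) − v0)/umax. -/
/-- A trajectory whose speed is bounded above by `v0 + umax (t - t0)` cannot
cover the control-zone length `L` before time `t0 + (√(2 L umax + v0²) - v0)/umax`. -/
theorem merging_time_lower_bound
    (t0 tm umax v0 L : ℝ)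
    (ht : t0 < tm) (humax : 0 < umax) (hv0 : 0 ≤ v0) (hL : 0 < L)
    (p : ℝ → ℝ)
    (hdiff : ∀ t ∈ Set.Icc t0 tm, DifferentiableAt ℝ p t)
    (hderiv : ∀ t ∈ Set.Icc t0 tm, deriv p t ≤ v0 + umax * (t - t0))
    (hp0 : p t0 = 0) (hpm : p tm = L) :
    tm ≥ t0 + (Real.sqrt (2 * L * umax + v0^2) - v0) / umax := by
  have hg : ∀ t ∈ Set.Icc t0 tm,
      HasDerivAt (fun t => p t - (v0 * (t - t0) + umax / 2 * (t - t0) ^ 2))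
        (deriv p t - (v0 + umax * (t - t0))) t := by
    intro t h
    have h1 := (hasDerivAt_id t).sub_const t0
    have h2 := (hdiff t h).hasDerivAt.sub
      ((h1.const_mul v0).add ((h1.pow 2).const_mul (umax / 2)))
    refine h2.congr_deriv ?_
    simp only [id]
    push_cast
    ring
  obtain ⟨c, hc, hceq⟩ := exists_hasDerivAt_eq_slope _ _ ht
    (fun t h => (hg t h).continuousAt.continuousWithinAt)
    (fun t h => hg t (Set.Ioo_subset_Icc_self h))
  have hle := hderiv c (Set.Ioo_subset_Icc_self hc)
  have hpos : 0 < tm - t0 := sub_pos.2 ht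
  rw [eq_div_iff hpos.ne', hp0, hpm] at hceq
  have key : L ≤ v0 * (tm - t0) + umax / 2 * (tm - t0) ^ 2 := by
    have := mul_nonneg (sub_nonneg.2 hle) hpos.le
    nlinarith
  have hs : Real.sqrt (2 * L * umax + v0^2) ≤ v0 + umax * (tm - t0) := by
    apply Real.sqrt_le_iff.2
    refine ⟨by positivity, ?_⟩
    have := mul_le_mul_of_nonneg_left key humax.le
    nlinarith
  have : (Real.sqrt (2 * L * umax + v0^2) - v0) / umax ≤ tm - t0 := by
    rw [div_le_iff₀ humax]
    linarith
  linarith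
end

section
/- Let uB < 0, 0 < vmin < vmax, and δ > 0, and suppose the parameter condition (vmin − vmax)/uB ≥ δ/vmin holds. Let pk : [tk0, ∞) → ℝ be differentiable with pk(tk0) = 0 and pk'(t) ≥ vmin for all t ≥ tk0. Then for τ = tk0 + (vmin − vmax)/uB we have pk(τ) ≥ δ; that is, if the following vehicle enters the control zone at time τ (with speed vmin, after decelerating at rate uB from vmax through the feasibility enforcement zone of length F̄ = (vmin² − vmax²)/(2·uB)), it enters at a distance of at least δ behind its predecessor. -/
/-- Under the parameter condition `(vmin - vmax)/uB ≥ δ/vmin`, a predecessor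
entering the control zone at time `tk0` at position `0` with speed at least `vmin` is at
distance at least `δ` from the entry when the follower enters at time
`τ = tk0 + (vmin - vmax)/uB`. -/
theorem fez_entry_safety
    (uB vmin vmax δ tk0 : ℝ)
    (huB : uB < 0) (hvmin : 0 < vmin) (hvv : vmin < vmax) (hδ : 0 < δ)
    (hparam : (vmin - vmax) / uB ≥ δ / vmin)
    (pk : ℝ → ℝ)
    (hdiff : ∀ t : ℝ, tk0 ≤ t → DifferentiableAt ℝ pk t)
    (hderiv : ∀ t : ℝ, tk0 ≤ t → deriv pk t ≥ vmin)
    (hp0 : pk tk0 = 0) :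
    pk (tk0 + (vmin - vmax) / uB) ≥ δ := by
  have hT : 0 < (vmin - vmax) / uB := div_pos_of_neg_of_neg (by linarith) huB
  have h1 : δ ≤ (vmin - vmax) / uB * vmin := (div_le_iff₀ hvmin).1 hparam
  have h2 := (convex_Ici tk0).mul_sub_le_image_sub_of_le_deriv
    (f := pk) (C := vmin)
    (fun t ht => (hdiff t ht).continuousAt.continuousWithinAt)
    (fun t ht => (hdiff t (interior_subset ht)).differentiableWithinAt)
    (fun t ht => hderiv t (interior_subset ht))
    tk0 Set.self_mem_Ici (tk0 + (vmin - vmax) / uB)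
    (Set.mem_Ici.2 (by linarith)) (by linarith)
  rw [hp0] at h2
  nlinarith
end

section
/- Let uB < 0, 0 < vmin < vmax, and δ > 0 satisfy the parameter condition (vmin − vmax)/uB ≥ δ/vmin. Let N ≥ 1 and let τ₀ < τ₁ < … < τ_N be entry times with τⱼ − τⱼ₋₁ ≥ δ/vmin for each j ∈ {1, …, N}. For each j ∈ {0, …, N} let pⱼ : [τⱼ, ∞) → ℝ be differentiable with pⱼ(τⱼ) = 0 and pⱼ'(t) ≥ vmin for all t ≥ τⱼ. Then for every j ∈ {1, …, N}, pⱼ₋₁(τⱼ) − pⱼ(τⱼ) ≥ δ; that is, every one of the N vehicles queued in the feasibility enforcement zone enters the control zone at a distance of at least δ behind its predecessor. -/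
/-- Under the parameter condition `(vmin - vmax)/uB ≥ δ/vmin`, if `N + 1`
consecutive vehicles enter the control zone at times spaced by at least `δ/vmin`, each at
position `0` and thereafter traveling with speed at least `vmin`, then every vehicle enters
at a distance of at least `δ` behind its predecessor. -/
theorem fez_queue_safety
    (uB vmin vmax δ : ℝ)
    (huB : uB < 0) (hvmin : 0 < vmin) (hvv : vmin < vmax) (hδ : 0 < δ)
    (hparam : (vmin - vmax) / uB ≥ δ / vmin)
    (N : ℕ) (hN : 1 ≤ N)
    (τ : ℕ → ℝ)
    (hτmono : ∀ j, 1 ≤ j → j ≤ N → τ (j - 1) < τ j)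
    (hτgap : ∀ j, 1 ≤ j → j ≤ N → τ j - τ (j - 1) ≥ δ / vmin)
    (p : ℕ → ℝ → ℝ)
    (hp0 : ∀ j, j ≤ N → p j (τ j) = 0)
    (hdiff : ∀ j, j ≤ N → ∀ t : ℝ, τ j ≤ t → DifferentiableAt ℝ (p j) t)
    (hderiv : ∀ j, j ≤ N → ∀ t : ℝ, τ j ≤ t → deriv (p j) t ≥ vmin) :
    ∀ j, 1 ≤ j → j ≤ N → p (j - 1) (τ j) - p j (τ j) ≥ δ := by
  intro j h1 hj
  have hj' : j - 1 ≤ N := by omega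
  have hlt := hτmono j h1 hj
  obtain ⟨c, hc, hceq⟩ := exists_deriv_eq_slope (p (j - 1)) hlt
    (fun t ht => (hdiff _ hj' t ht.1).continuousAt.continuousWithinAt)
    (fun t ht => (hdiff _ hj' t ht.1.le).differentiableWithinAt)
  have hd := hderiv _ hj' c hc.1.le
  have hpos : 0 < τ j - τ (j - 1) := sub_pos.mpr hlt
  rw [hceq, hp0 _ hj', ge_iff_le, le_div_iff₀ hpos] at hd
  have hg := hτgap j h1 hj
  rw [ge_iff_le, div_le_iff₀ hvmin] at hg
  rw [hp0 j hj]
  linarith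
end
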